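/- Let G be a group and let S ⊆ G be a symmetric subset (s ∈ S implies s⁻¹ ∈ S) generating G. Let σ : G → ℝ and C > 0 satisfy: (i) σ(1) = 0, (ii) σ(a*b) = σ(b*a) for all a, b ∈ G, and (iii) |σ(s*ψ) − σ(s) − σ(ψ)| ≤ C for all s ∈ S and all ψ ∈ G. For φ ∈ G let ‖φ‖_S denote the least n ≥ 0 such that φ is a product of n elements of S (so ‖1‖_S = 0). Then for all φ, ψ ∈ G, |σ(φ*ψ) − σ(φ) − σ(ψ)| ≤ 2C·min(‖φ‖_S, ‖ψ‖_S). -/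

import Mathlib

/-- The word norm of `φ` with respect to a subset `S` of a group `G`:
the least `n` such that `φ` is a product of `n` elements of `S`. -/
noncomputable def wordNorm {G : Type*} [Group G] (S : Set G) (φ : G) : ℕ :=
  sInf {n : ℕ | ∃ l : List G, (∀ s ∈ l, s ∈ S) ∧ l.length = n ∧ l.prod = φ}

/-- If left multiplication by elements of `S` is additive for `σ` up to `C`, then left
multiplication by a product of elements of `S` is additive up to `2 * C` times its length. -/
theorem abs_defect_list_prod_le {G : Type*} [Group G] {S : Set G} {σ : G → ℝ} {C : ℝ}
    (hone : σ 1 = 0) (hdefect : ∀ s ∈ S, ∀ ψ : G, |σ (s * ψ) - σ s - σ ψ| ≤ C)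
    (ψ : G) (l : List G) (hl : ∀ s ∈ l, s ∈ S) :
    |σ (l.prod * ψ) - σ l.prod - σ ψ| ≤ 2 * C * l.length := by
  induction l with
  | nil => simp [hone]
  | cons s l ih =>
    have hs : s ∈ S := hl s List.mem_cons_self
    have ih := abs_le.mp (ih fun t ht => hl t (List.mem_cons_of_mem s ht))
    have h₁ := abs_le.mp (hdefect s hs (l.prod * ψ))
    have h₂ := abs_le.mp (hdefect s hs l.prod)
    rw [List.prod_cons, List.length_cons, mul_assoc, abs_le]
    push_cast
    constructor <;> linarith

/-- In a group generated by a symmetric set, every element is a product of `wordNorm S φ`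
generators. -/
theorem exists_list_length_eq_wordNorm {G : Type*} [Group G] {S : Set G}
    (hsymm : ∀ s ∈ S, s⁻¹ ∈ S) (hgen : Subgroup.closure S = ⊤) (φ : G) :
    ∃ l : List G, (∀ s ∈ l, s ∈ S) ∧ l.length = wordNorm S φ ∧ l.prod = φ := by
  refine Nat.sInf_mem (s := {n : ℕ | ∃ l : List G, (∀ s ∈ l, s ∈ S) ∧ l.length = n ∧ l.prod = φ}) ?_
  have hφ : φ ∈ (Subgroup.closure S).toSubmonoid := hgen ▸ Subgroup.mem_top φ
  rw [Subgroup.closure_toSubmonoid] at hφ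
  obtain ⟨l, hl, hprod⟩ := Submonoid.exists_list_of_mem_closure hφ
  refine ⟨l.length, l, fun s hs => ?_, rfl, hprod⟩
  exact (hl s hs).elim id fun h => inv_inv s ▸ hsymm _ h

theorem partial_quasi_additivity {G : Type*} [Group G]
    (S : Set G) (hsymm : ∀ s ∈ S, s⁻¹ ∈ S) (hgen : Subgroup.closure S = ⊤)
    (σ : G → ℝ) (C : ℝ) (hC : 0 < C)
    (hone : σ 1 = 0)
    (hcomm : ∀ a b : G, σ (a * b) = σ (b * a))
    (hdefect : ∀ s ∈ S, ∀ ψ : G, |σ (s * ψ) - σ s - σ ψ| ≤ C) :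
    ∀ φ ψ : G, |σ (φ * ψ) - σ φ - σ ψ| ≤
      2 * C * min (wordNorm S φ : ℝ) (wordNorm S ψ : ℝ) := by
  have key : ∀ φ ψ : G, |σ (φ * ψ) - σ φ - σ ψ| ≤ 2 * C * wordNorm S φ := fun φ ψ => by
    obtain ⟨l, hl, hlen, rfl⟩ := exists_list_length_eq_wordNorm hsymm hgen φ
    rw [← hlen]
    exact abs_defect_list_prod_le hone hdefect ψ l hl
  intro φ ψ
  rw [mul_min_of_nonneg _ _ (by positivity), le_min_iff]
  refine ⟨key φ ψ, ?_⟩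
  rw [hcomm, sub_right_comm]
  exact key ψ φ
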